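/- Every local good semigroup S' ⊆ ℕ² with S' ≠ ℕ²(1,1) can be obtained by removing a track from a local good semigroup of genus g(S')−1; that is, there exist a local good semigroup S ⊆ ℕ² with g(S) = g(S')−1 and a track T of S such that S' = S∖T. -/

import Mathlib

/-- The ambient space `ℤ²`; `ℕ²` is identified with the nonnegative orthant. -/
abbrev Z2 : Type := ℤ × ℤ

/-- The nonnegative orthant, representing `ℕ² ⊆ ℤ²`. -/
def orth : Set Z2 := {a : Z2 | 0 ≤ a.1 ∧ 0 ≤ a.2}

/-- Property (G1): closure under componentwise minimum. -/
def MinClosed (E : Set Z2) : Prop := ∀ a ∈ E, ∀ b ∈ E, a ⊓ b ∈ E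

/-- Property (G3). -/
def G3P (E : Set Z2) : Prop :=
  ∀ a ∈ E, ∀ b ∈ E, a ≠ b →
    (a.1 = b.1 →
      ∃ e ∈ E, a.1 < e.1 ∧ min a.2 b.2 ≤ e.2 ∧ (a.2 ≠ b.2 → e.2 = min a.2 b.2)) ∧
    (a.2 = b.2 →
      ∃ e ∈ E, a.2 < e.2 ∧ min a.1 b.1 ≤ e.1 ∧ (a.1 ≠ b.1 → e.1 = min a.1 b.1))

/-- A good semigroup of `ℕ²` (viewed inside `ℤ²`). -/
def IsGood (S : Set Z2) : Prop :=
  S ⊆ orth ∧ (0 : Z2) ∈ S ∧ (∀ a ∈ S, ∀ b ∈ S, a + b ∈ S) ∧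
  MinClosed S ∧ (∃ δ : Z2, ∀ y : Z2, δ ≤ y → y ∈ S) ∧ G3P S

/-- A good semigroup is local if its only element with a zero coordinate is `0`. -/
def IsLocal (S : Set Z2) : Prop := ∀ a ∈ S, (a.1 = 0 ∨ a.2 = 0) → a = 0

/-- A relative good ideal of `S`. -/
def IsRelGoodIdeal (S E : Set Z2) : Prop :=
  E.Nonempty ∧ (∀ e ∈ E, ∀ s ∈ S, e + s ∈ E) ∧ (∃ a ∈ S, ∀ e ∈ E, a + e ∈ S) ∧
  MinClosed E ∧ G3P E

/-- A saturated chain of length `n` in `E`. -/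
def IsSatChain (E : Set Z2) (n : ℕ) (f : ℕ → Z2) : Prop :=
  (∀ i ≤ n, f i ∈ E) ∧ (∀ i < n, f i < f (i + 1)) ∧
  (∀ i < n, ∀ c ∈ E, ¬ (f i < c ∧ c < f (i + 1)))

/-- `d_E(a,b)`: the common length of all saturated chains in `E` from `a` to `b`. -/
noncomputable def chainDist (E : Set Z2) (a b : Z2) : ℕ :=
  sSup {n : ℕ | ∃ f : ℕ → Z2, IsSatChain E n f ∧ f 0 = a ∧ f n = b}

/-- The (componentwise) minimal element `e(E)` of `E`. -/
noncomputable def minEl (E : Set Z2) : Z2 :=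
  (sInf (Prod.fst '' E), sInf (Prod.snd '' E))

/-- The distance `d(E∖F)` between `F ⊆ E`: the common value of
`d_E(e(E),α) - d_F(e(F),α)` for all sufficiently large `α ∈ F`. -/
noncomputable def dist2 (E F : Set Z2) : ℤ :=
  sSup {z : ℤ | ∃ β : Z2, ∀ α ∈ F, β ≤ α →
    (chainDist E (minEl E) α : ℤ) - (chainDist F (minEl F) α : ℤ) = z}

/-- The conductor `c(E)`: the componentwise minimal `δ` with `δ + ℕ² ⊆ E`. -/
noncomputable def condE (E : Set Z2) : Z2 :=
  (sInf ((fun δ : Z2 => δ.1) '' {δ : Z2 | ∀ y : Z2, δ ≤ y → y ∈ E}),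
   sInf ((fun δ : Z2 => δ.2) '' {δ : Z2 | ∀ y : Z2, δ ≤ y → y ∈ E}))

/-- The conductor ideal `C(E) = {β ∈ E : β ≥ c(E)}`. -/
noncomputable def CIdeal (E : Set Z2) : Set Z2 := {b ∈ E | condE E ≤ b}

/-- The length `l(E) = d(E ∖ C(E))`. -/
noncomputable def glen (E : Set Z2) : ℤ := dist2 E (CIdeal E)

/-- The genus `g(E) = d(ℕ² ∖ E)`. -/
noncomputable def genus (E : Set Z2) : ℤ := dist2 orth E

/-- The good semigroup `ℕ²(1,1) = {0} ∪ ((1,1) + ℕ²)`. -/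
def N2oneone : Set Z2 := {a : Z2 | a = 0 ∨ ((1 : ℤ), (1 : ℤ)) ≤ a}
/-- The space `(ℕ ∪ {∞})²`, modelled inside `(ℤ ∪ {∞})²`. -/
abbrev Om : Type := WithTop ℤ × WithTop ℤ

/-- The embedding of `ℤ²` into `(ℤ ∪ {∞})²`. -/
def iotaZ (a : Z2) : Om := ((a.1 : WithTop ℤ), (a.2 : WithTop ℤ))

/-- `S^∞`: the elements `(a,∞)` with `(a,c₂) ∈ S` and `(∞,b)` with `(c₁,b) ∈ S`,
where `(c₁,c₂)` is the conductor of `S`. -/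
noncomputable def Sinf (S : Set Z2) : Set Om :=
  {w : Om | (∃ a : ℤ, w = ((a : WithTop ℤ), ⊤) ∧ (a, (condE S).2) ∈ S) ∨
            (∃ b : ℤ, w = (⊤, (b : WithTop ℤ)) ∧ ((condE S).1, b) ∈ S)}

/-- `Γ_S = S ∪ S^∞`. -/
noncomputable def Gam (S : Set Z2) : Set Om := iotaZ '' S ∪ Sinf S

/-- `I(S)`: the set of irreducible elements of `Γ_S`. -/
noncomputable def ISet (S : Set Z2) : Set Om :=
  {w ∈ Gam S | w ≠ 0 ∧ ∀ b ∈ Gam S, ∀ c ∈ Gam S, w = b + c → w = b ∨ w = c}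

/-- `Δ(a) = Δ₁(a) ∪ Δ₂(a)` for a finite element `a ∈ ℤ²`. -/
def DeltaUp (a : Z2) : Set Z2 :=
  {b : Z2 | (b.1 = a.1 ∧ a.2 < b.2) ∨ (b.2 = a.2 ∧ a.1 < b.1)}

/-- `A_f(S)`: the finite maximals of `S`, i.e. `a ∈ S` with `Δ^S(a) = ∅`. -/
def Af (S : Set Z2) : Set Z2 := {a ∈ S | S ∩ DeltaUp a = ∅}

/-- `I_A(S)`: the irreducible maximals, i.e. irreducible elements of
`A(S) = A_f(S) ∪ S^∞`. -/
noncomputable def IA (S : Set Z2) : Set Om := ISet S ∩ (iotaZ '' Af S ∪ Sinf S)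

/-- `₁Δ(w)` (as a subset of `ℤ²`), including the conventions for infinite `w`. -/
def lowD1 (w : Om) : Set Z2 :=
  {b : Z2 | (b.1 : WithTop ℤ) = w.1 ∧ (b.2 : WithTop ℤ) < w.2}

/-- `₂Δ(w)` (as a subset of `ℤ²`), including the conventions for infinite `w`. -/
def lowD2 (w : Om) : Set Z2 :=
  {b : Z2 | (b.2 : WithTop ℤ) = w.2 ∧ (b.1 : WithTop ℤ) < w.1}

/-- `Δ(w)` (as a subset of `ℤ²`) for a possibly infinite `w`. -/
def upD (w : Om) : Set Z2 :=
  {b : Z2 | ((b.1 : WithTop ℤ) = w.1 ∧ w.2 < (b.2 : WithTop ℤ)) ∨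
            ((b.2 : WithTop ℤ) = w.2 ∧ w.1 < (b.1 : WithTop ℤ))}

/-- `{w} ∩ ℤ²`: the singleton of `w` if `w` is finite, `∅` otherwise. -/
def finPart (w : Om) : Set Z2 := {b : Z2 | iotaZ b = w}

/-- `a` and `b` are connected by a piece of track. -/
def Piece (S : Set Z2) (a b : Om) : Prop :=
  ¬ a ≤ b ∧ ¬ b ≤ a ∧ ∀ s ∈ S, s ∈ upD (a ⊓ b) → iotaZ s ∈ ISet S

/-- The data `α 0, …, α (n-1)` of a track of `S` (with `n ≥ 1` points;
`n = 1` gives the one-point tracks `T((α))`). -/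
def TrackData (S : Set Z2) (n : ℕ) (α : ℕ → Om) : Prop :=
  1 ≤ n ∧ (∀ i < n, α i ∈ IA S) ∧
  (∀ i j, i < j → j < n → (α i).1 < (α j).1) ∧
  (∀ s ∈ S, s ∈ lowD2 (α 0) → iotaZ s ∈ ISet S) ∧
  (∀ s ∈ S, s ∈ lowD1 (α (n - 1)) → iotaZ s ∈ ISet S) ∧
  (∀ i, i + 1 < n → Piece S (α i) (α (i + 1)))

/-- The track `T((α 0,…,α (n-1)))` as a subset of `S`. -/
def trackSet (S : Set Z2) (n : ℕ) (α : ℕ → Om) : Set Z2 :=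
  finPart (α 0) ∪ S ∩ lowD2 (α 0) ∪
  (⋃ i ∈ Finset.range (n - 1), S ∩ upD (α i ⊓ α (i + 1))) ∪
  S ∩ lowD1 (α (n - 1)) ∪ finPart (α (n - 1))

/-- `T` is a track of `S`. -/
def IsTrack (S T : Set Z2) : Prop :=
  ∃ (n : ℕ) (α : ℕ → Om), TrackData S n α ∧ T = trackSet S n α

/-- `T` is a beyond track of `S`: a track meeting `{a ∈ S : a ≥ c(S)}`. -/
noncomputable def IsBeyondTrack (S T : Set Z2) : Prop :=
  IsTrack S T ∧ (T ∩ {a ∈ S | condE S ≤ a}).Nonempty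

/-- `S` is a special parent of `S'`: `S` is a (local) good semigroup and
`S' = S ∖ T` for some beyond track `T` of `S`. -/
noncomputable def SpecialParent (S S' : Set Z2) : Prop :=
  IsGood S ∧ IsLocal S ∧ ∃ T : Set Z2, IsBeyondTrack S T ∧ S' = S \ T

/-! ### The height function of a good set -/

/-- `E` has an element on the vertical line through `(x, y)`, at or above it. -/
def HasCol (E : Set Z2) (x y : ℕ) : Prop := ∃ t : ℤ, (y : ℤ) ≤ t ∧ ((x : ℤ), t) ∈ E

/-- `E` has an element on the horizontal line through `(x, y)`, at or to the right of it. -/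
def HasRow (E : Set Z2) (x y : ℕ) : Prop := ∃ t : ℤ, (x : ℤ) ≤ t ∧ (t, (y : ℤ)) ∈ E

open Classical in
/-- The number of unit steps on the path `(0,0) → (x,0) → (x,y)` that cross an element of `E`. -/
noncomputable def height (E : Set Z2) (x y : ℕ) : ℕ :=
  (∑ i ∈ Finset.range x, if HasCol E i 0 then 1 else 0) +
    ∑ j ∈ Finset.range y, if HasRow E x j then 1 else 0

lemma height_zero (E : Set Z2) : height E 0 0 = 0 := by simp [height]

open Classical in
lemma height_succ_right (E : Set Z2) (x y : ℕ) :
    height E x (y + 1) = height E x y + if HasRow E x y then 1 else 0 := by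
  simp only [height, Finset.sum_range_succ]; ring

open Classical in
lemma step_exchange {E : Set Z2} (h3 : G3P E) (x y : ℕ) :
    ((if HasCol E x y then 1 else 0) + if HasRow E (x + 1) y then 1 else 0) =
      (if HasRow E x y then 1 else 0) + if HasCol E x (y + 1) then 1 else 0 := by
  have hc : HasCol E x (y + 1) → HasCol E x y := by
    rintro ⟨t, ht, h⟩; exact ⟨t, by push_cast at ht; omega, h⟩
  have hr : HasRow E (x + 1) y → HasRow E x y := by
    rintro ⟨t, ht, h⟩; exact ⟨t, by push_cast at ht; omega, h⟩
  by_cases hm : ((x : ℤ), (y : ℤ)) ∈ E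
  · have h1 : HasCol E x y := ⟨y, le_rfl, hm⟩
    have h2 : HasRow E x y := ⟨x, le_rfl, hm⟩
    have h4 : HasRow E (x + 1) y ↔ HasCol E x (y + 1) := by
      constructor
      · rintro ⟨t, ht, h⟩
        push_cast at ht
        obtain ⟨e, he, e1, -, e2⟩ := (h3 _ hm _ h (by simp; omega)).2 rfl
        have e2 := e2 (by simp; omega)
        simp only at e1 e2
        refine ⟨e.2, by push_cast; omega, ?_⟩
        convert he using 1
        ext <;> simp; omega
      · rintro ⟨t, ht, h⟩
        push_cast at ht
        obtain ⟨e, he, e1, -, e2⟩ := (h3 _ hm _ h (by simp; omega)).1 rfl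
        have e2 := e2 (by simp; omega)
        simp only at e1 e2
        refine ⟨e.1, by push_cast; omega, ?_⟩
        convert he using 1
        ext <;> simp; omega
    simp [h1, h2, h4]
  · have h1 : HasCol E x y → HasCol E x (y + 1) := by
      rintro ⟨t, ht, h⟩
      refine ⟨t, ?_, h⟩
      rcases ht.eq_or_lt with rfl | h'
      · exact absurd h hm
      · push_cast; omega
    have h2 : HasRow E x y → HasRow E (x + 1) y := by
      rintro ⟨t, ht, h⟩
      refine ⟨t, ?_, h⟩
      rcases ht.eq_or_lt with rfl | h'
      · exact absurd h hm
      · push_cast; omega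
    have e1 : HasCol E x y ↔ HasCol E x (y + 1) := ⟨h1, hc⟩
    have e2 : HasRow E x y ↔ HasRow E (x + 1) y := ⟨h2, hr⟩
    simp only [e1, e2]; ring

open Classical in
lemma height_succ_left {E : Set Z2} (h3 : G3P E) (x y : ℕ) :
    height E (x + 1) y = height E x y + if HasCol E x y then 1 else 0 := by
  induction y with
  | zero =>
    simp only [height, Finset.sum_range_succ, Finset.range_zero, Finset.sum_empty, add_zero]
  | succ y ih =>
    rw [height_succ_right, height_succ_right, ih]
    have := step_exchange h3 x y
    omega

lemma height_add_left_of_not {E : Set Z2} (h3 : G3P E) (x y k : ℕ)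
    (h : ∀ i < k, ¬ HasCol E (x + i) y) : height E (x + k) y = height E x y := by
  induction k with
  | zero => rfl
  | succ k ih =>
    rw [← add_assoc, height_succ_left h3, if_neg (h k (by omega)), add_zero]
    exact ih fun i hi => h i (by omega)

lemma height_add_right_of_not {E : Set Z2} (x y k : ℕ)
    (h : ∀ i < k, ¬ HasRow E x (y + i)) : height E x (y + k) = height E x y := by
  induction k with
  | zero => rfl
  | succ k ih =>
    rw [← add_assoc, height_succ_right, if_neg (h k (by omega)), add_zero]
    exact ih fun i hi => h i (by omega)

lemma z2_lt_iff (a b : Z2) : a < b ↔ a.1 ≤ b.1 ∧ a.2 ≤ b.2 ∧ (a.1 < b.1 ∨ a.2 < b.2) := by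
  rw [Prod.lt_iff]; omega

lemma height_of_consecutive {E : Set Z2} (hm : MinClosed E) (h3 : G3P E) (x y x' y' : ℕ)
    (ha : ((x : ℤ), (y : ℤ)) ∈ E) (hb : ((x' : ℤ), (y' : ℤ)) ∈ E)
    (hlt : ((x : ℤ), (y : ℤ)) < ((x' : ℤ), (y' : ℤ)))
    (hcons : ∀ c ∈ E, ¬ (((x : ℤ), (y : ℤ)) < c ∧ c < ((x' : ℤ), (y' : ℤ)))) :
    height E x' y' = height E x y + 1 := by
  simp only [z2_lt_iff] at hlt hcons
  by_cases hx : x < x'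
  · obtain ⟨k, rfl⟩ : ∃ k, x' = x + 1 + k := ⟨x' - (x + 1), by omega⟩
    obtain ⟨l, rfl⟩ : ∃ l, y' = y + l := ⟨y' - y, by omega⟩
    rw [height_add_right_of_not, height_add_left_of_not h3, height_succ_left h3, if_pos]
    · exact ⟨y, le_rfl, ha⟩
    · rintro i hi ⟨t, ht, h⟩
      refine hcons _ (hm _ h _ hb) ?_
      simp only [Prod.fst_inf, Prod.snd_inf]
      push_cast
      omega
    · rintro i hi ⟨t, ht, h⟩
      refine hcons _ (hm _ h _ hb) ?_
      simp only [Prod.fst_inf, Prod.snd_inf]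
      push_cast at *
      omega
  · obtain rfl : x = x' := by omega
    obtain ⟨l, rfl⟩ : ∃ l, y' = y + 1 + l := ⟨y' - (y + 1), by omega⟩
    rw [height_add_right_of_not, height_succ_right, if_pos]
    · exact ⟨x, le_rfl, ha⟩
    · rintro i hi ⟨t, ht, h⟩
      refine hcons _ (hm _ h _ hb) ?_
      simp only [Prod.fst_inf, Prod.snd_inf]
      push_cast at *
      omega

/-! ### Chain distance and genus -/

lemma height_of_satChain {E : Set Z2} (ho : E ⊆ orth) (hm : MinClosed E) (h3 : G3P E)
    {n : ℕ} {f : ℕ → Z2} (hf : IsSatChain E n f) (h0 : f 0 = 0) :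
    ∀ i ≤ n, height E (f i).1.toNat (f i).2.toNat = i := by
  intro i
  induction i with
  | zero => intro _; simp [h0, height_zero]
  | succ i ih =>
    intro hi
    have cast_eq : ∀ j ≤ n, (((f j).1.toNat : ℤ), ((f j).2.toNat : ℤ)) = f j := by
      intro j hj
      have := ho (hf.1 j hj)
      ext
      · exact Int.toNat_of_nonneg this.1
      · exact Int.toNat_of_nonneg this.2
    have e1 := cast_eq i (by omega)
    have e2 := cast_eq (i + 1) hi
    rw [height_of_consecutive hm h3 (f i).1.toNat (f i).2.toNat, ih (by omega)]
    · rw [e1]; exact hf.1 i (by omega)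
    · rw [e2]; exact hf.1 _ hi
    · rw [e1, e2]; exact hf.2.1 i (by omega)
    · rw [e1, e2]; exact hf.2.2 i (by omega)

lemma exists_satChain {E : Set Z2} (ho : E ⊆ orth) (h0 : (0 : Z2) ∈ E) (N : ℕ) :
    ∀ b ∈ E, (b.1 + b.2).toNat = N →
      ∃ (n : ℕ) (f : ℕ → Z2), IsSatChain E n f ∧ f 0 = 0 ∧ f n = b := by
  induction N using Nat.strong_induction_on with
  | _ N ih =>
    intro b hb hN
    by_cases hb0 : b = 0
    · exact ⟨0, fun _ => 0, ⟨fun _ _ => h0, by simp, by simp⟩, rfl, hb0.symm⟩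
    have hbo : 0 ≤ b.1 ∧ 0 ≤ b.2 := ho hb
    have hpos : (0 : Z2) < b := lt_of_le_of_ne ⟨hbo.1, hbo.2⟩ (Ne.symm hb0)
    obtain ⟨z, ⟨c, hc, hcb, rfl⟩, hz⟩ := Int.exists_greatest_of_bdd
      (P := fun z => ∃ c ∈ E, c < b ∧ c.1 + c.2 = z)
      ⟨b.1 + b.2, by rintro z ⟨c, _, hc, rfl⟩; rw [z2_lt_iff] at hc; omega⟩
      ⟨0, 0, h0, hpos, rfl⟩
    have hco : 0 ≤ c.1 ∧ 0 ≤ c.2 := ho hc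
    have hcb' := (z2_lt_iff _ _).1 hcb
    obtain ⟨n, f, hf, hf0, hfn⟩ := ih (c.1 + c.2).toNat (by omega) c hc rfl
    refine ⟨n + 1, fun i => if i ≤ n then f i else b, ⟨?_, ?_, ?_⟩, by simpa using hf0, by simp⟩
    · intro i _
      by_cases hi : i ≤ n
      · simpa [hi] using hf.1 i hi
      · simpa [hi] using hb
    · intro i hi
      rcases Nat.lt_succ_iff_lt_or_eq.1 hi with h | rfl
      · simpa [h.le, Nat.succ_le_of_lt h] using hf.2.1 i h
      · simpa [hfn] using hcb
    · intro i hi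
      rcases Nat.lt_succ_iff_lt_or_eq.1 hi with h | rfl
      · simpa [h.le, Nat.succ_le_of_lt h] using hf.2.2 i h
      · intro d hd
        simp only [le_refl, if_true, hfn, Nat.not_succ_le_self, if_false]
        rintro ⟨h1, h2⟩
        have := hz _ ⟨d, hd, h2, rfl⟩
        rw [z2_lt_iff] at h1
        omega

lemma chainDist_eq_height {E : Set Z2} (hE : IsGood E) {b : Z2} (hb : b ∈ E) :
    chainDist E 0 b = height E b.1.toNat b.2.toNat := by
  obtain ⟨ho, h0, -, hm, -, h3⟩ := hE
  have : {n : ℕ | ∃ f : ℕ → Z2, IsSatChain E n f ∧ f 0 = 0 ∧ f n = b} =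
      {height E b.1.toNat b.2.toNat} := by
    have key : ∀ n (f : ℕ → Z2), IsSatChain E n f → f 0 = 0 → f n = b →
        n = height E b.1.toNat b.2.toNat := by
      rintro n f hf hf0 rfl
      exact (height_of_satChain ho hm h3 hf hf0 n le_rfl).symm
    ext n
    simp only [Set.mem_ofPred_eq, Set.mem_singleton_iff]
    constructor
    · rintro ⟨f, hf, hf0, hfn⟩
      exact key n f hf hf0 hfn
    · rintro rfl
      obtain ⟨n, f, hf, hf0, hfn⟩ := exists_satChain ho h0 _ b hb rfl
      rw [← key n f hf hf0 hfn]
      exact ⟨f, hf, hf0, hfn⟩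
  rw [chainDist, this, csSup_singleton]

lemma minEl_eq_zero {E : Set Z2} (hE : IsGood E) : minEl E = 0 := by
  obtain ⟨ho, h0, -⟩ := hE
  have h1 : IsLeast (Prod.fst '' E) 0 :=
    ⟨⟨0, h0, rfl⟩, by rintro _ ⟨a, ha, rfl⟩; exact (ho ha).1⟩
  have h2 : IsLeast (Prod.snd '' E) 0 :=
    ⟨⟨0, h0, rfl⟩, by rintro _ ⟨a, ha, rfl⟩; exact (ho ha).2⟩
  rw [minEl, h1.csInf_eq, h2.csInf_eq]; rfl

lemma isGood_orth : IsGood orth := by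
  refine ⟨fun _ h => h, ⟨le_rfl, le_rfl⟩, ?_, ?_, ⟨0, fun y hy => ⟨hy.1, hy.2⟩⟩, ?_⟩
  · rintro a ⟨h1, h2⟩ b ⟨h3, h4⟩
    exact ⟨add_nonneg h1 h3, add_nonneg h2 h4⟩
  · rintro a ⟨h1, h2⟩ b ⟨h3, h4⟩
    exact ⟨le_min h1 h3, le_min h2 h4⟩
  · rintro a ⟨h1, h2⟩ b ⟨h3, h4⟩ -
    refine ⟨fun h => ⟨(a.1 + 1, min a.2 b.2), ⟨?_, ?_⟩, ?_, le_rfl, fun _ => rfl⟩,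
      fun h => ⟨(min a.1 b.1, a.2 + 1), ⟨?_, ?_⟩, ?_, le_rfl, fun _ => rfl⟩⟩ <;>
    simp <;> omega

lemma height_add_of_conductor {E : Set Z2} (h3 : G3P E) (x y : ℕ)
    (hδ : ∀ z : Z2, ((x : ℤ), (y : ℤ)) ≤ z → z ∈ E) (i j : ℕ) :
    height E (x + i) (y + j) = height E x y + i + j := by
  induction j with
  | succ j ih =>
    rw [← add_assoc y, height_succ_right, ih, if_pos]
    · ring
    · exact ⟨(x + i : ℕ), le_rfl, hδ _ ⟨by simp, by simp⟩⟩
  | zero =>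
    induction i with
    | zero => rfl
    | succ i ih =>
      rw [← add_assoc x, height_succ_left h3, ih, if_pos]
      · ring
      · exact ⟨(y + 0 : ℕ), le_rfl, hδ _ ⟨by simp, by simp⟩⟩

lemma height_orth (x y : ℕ) : height orth x y = x + y := by
  have := height_add_of_conductor isGood_orth.2.2.2.2.2 0 0
    (fun z hz => ⟨by simpa using hz.1, by simpa using hz.2⟩) x y
  simpa [height_zero] using this

lemma genus_eq {E : Set Z2} (hE : IsGood E) (x y : ℕ)
    (hδ : ∀ z : Z2, ((x : ℤ), (y : ℤ)) ≤ z → z ∈ E) :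
    genus E = (x : ℤ) + y - height E x y := by
  have key : ∀ a ∈ E, ((x : ℤ), (y : ℤ)) ≤ a →
      (chainDist orth (minEl orth) a : ℤ) - chainDist E (minEl E) a =
        (x : ℤ) + y - height E x y := by
    rintro ⟨a1, a2⟩ ha ⟨h1, h2⟩
    simp only at h1 h2
    obtain ⟨i, hi⟩ := Int.eq_ofNat_of_zero_le (sub_nonneg.2 h1)
    obtain ⟨j, hj⟩ := Int.eq_ofNat_of_zero_le (sub_nonneg.2 h2)
    obtain rfl : a1 = ((x + i : ℕ) : ℤ) := by push_cast; omega
    obtain rfl : a2 = ((y + j : ℕ) : ℤ) := by push_cast; omega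
    rw [minEl_eq_zero hE, minEl_eq_zero isGood_orth, chainDist_eq_height hE ha,
      chainDist_eq_height isGood_orth (hE.1 ha)]
    simp only [Int.toNat_natCast]
    rw [height_orth, height_add_of_conductor hE.2.2.2.2.2 x y hδ]
    push_cast; ring
  have : {z : ℤ | ∃ β : Z2, ∀ α ∈ E, β ≤ α →
      (chainDist orth (minEl orth) α : ℤ) - chainDist E (minEl E) α = z} =
        {(x : ℤ) + y - height E x y} := by
    ext z
    simp only [Set.mem_ofPred_eq, Set.mem_singleton_iff]
    constructor
    · rintro ⟨β, h⟩
      have hmem := hδ (β ⊔ ((x : ℤ), (y : ℤ))) le_sup_right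
      rw [← h _ hmem le_sup_left, key _ hmem le_sup_right]
    · rintro rfl
      exact ⟨_, key⟩
  rw [genus, dist2, this, csSup_singleton]

/-! ### Exchanging the two coordinates -/

/-- The image of `S` under the exchange of coordinates. -/
def swapSet (S : Set Z2) : Set Z2 := {a | (a.2, a.1) ∈ S}

lemma IsGood.swap {S : Set Z2} (hS : IsGood S) : IsGood (swapSet S) := by
  obtain ⟨ho, h0, ha, hm, ⟨δ, hδ⟩, h3⟩ := hS
  refine ⟨fun a h => ⟨(ho h).2, (ho h).1⟩, h0, fun a h b h' => ha _ h _ h',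
    fun a h b h' => hm _ h _ h', ⟨(δ.2, δ.1), fun y hy => hδ _ ⟨hy.2, hy.1⟩⟩, ?_⟩
  intro a h b h' hne
  have := h3 _ h _ h' (by
    intro h
    simp only [Prod.mk.injEq] at h
    exact hne (Prod.ext h.2 h.1))
  refine ⟨fun hab => ?_, fun hab => ?_⟩
  · obtain ⟨e, he, h1, h2, h3⟩ := this.2 hab
    exact ⟨(e.2, e.1), he, h1, h2, h3⟩
  · obtain ⟨e, he, h1, h2, h3⟩ := this.1 hab
    exact ⟨(e.2, e.1), he, h1, h2, h3⟩

lemma IsLocal.swap {S : Set Z2} (hS : IsLocal S) : IsLocal (swapSet S) := by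
  intro a ha h
  have := hS _ ha h.symm
  simp only [Prod.mk_eq_zero] at this
  exact Prod.ext this.2 this.1

lemma height_swapSet {S : Set Z2} (h3 : G3P S) (x y : ℕ) :
    height (swapSet S) y x = height S x y := by
  classical
  have hc : ∀ x y, HasRow (swapSet S) y x ↔ HasCol S x y := fun _ _ => Iff.rfl
  have hr : ∀ x y, HasCol (swapSet S) y x ↔ HasRow S x y := fun _ _ => Iff.rfl
  induction x with
  | succ x ih =>
    rw [height_succ_right, height_succ_left h3, ih]
    exact congrArg _ (if_congr (hc x y) rfl rfl)
  | zero =>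
    simp only [height, Finset.range_zero, Finset.sum_empty, zero_add, add_zero]
    exact Finset.sum_congr rfl fun i _ => if_congr (hr 0 i) rfl rfl

lemma genus_swapSet {S : Set Z2} (hS : IsGood S) : genus (swapSet S) = genus S := by
  obtain ⟨δ, hδ⟩ := hS.2.2.2.2.1
  have h : ∀ z : Z2, ((δ.1.toNat : ℤ), (δ.2.toNat : ℤ)) ≤ z → z ∈ S := fun z hz =>
    hδ z ⟨(Int.self_le_toNat _).trans hz.1, (Int.self_le_toNat _).trans hz.2⟩
  rw [genus_eq hS _ _ h, genus_eq hS.swap δ.2.toNat δ.1.toNat fun z hz => h _ ⟨hz.2, hz.1⟩,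
    height_swapSet hS.2.2.2.2.2]
  ring

/-! ### Rows, columns and the conductor -/

/-- A row of a good semigroup that meets `[δ₁, ∞)` contains all of it. -/
lemma row_mem {S : Set Z2} (hS : IsGood S) {δ : Z2} (hδ : ∀ y : Z2, δ ≤ y → y ∈ S)
    {a b : ℤ} (hab : (a, b) ∈ S) (ha : δ.1 ≤ a) {x : ℤ} (hx : δ.1 ≤ x) : (x, b) ∈ S := by
  obtain ⟨-, -, -, hm, -, h3⟩ := hS
  have unb : ∀ n : ℕ, ∃ t, a + n ≤ t ∧ (t, b) ∈ S := by
    intro n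
    induction n with
    | zero => exact ⟨a, by simp, hab⟩
    | succ n ih =>
      obtain ⟨t, ht, h⟩ := ih
      have h' : (t, max (b + 1) δ.2) ∈ S := hδ _ ⟨by simp; omega, by simp⟩
      obtain ⟨e, he, e1, -, e2⟩ := (h3 _ h _ h' (by simp; omega)).1 rfl
      have e2 := e2 (by simp; omega)
      simp only at e1 e2
      refine ⟨e.1, by push_cast; omega, ?_⟩
      convert he using 1
      ext <;> simp; omega
  obtain ⟨t, ht, h⟩ := unb (x - a).toNat
  have h' : (x, max b δ.2) ∈ S := hδ _ ⟨hx, by simp⟩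
  convert hm _ h _ h' using 1
  ext <;> simp; omega

/-- A column of a good semigroup that meets `[δ₂, ∞)` contains all of it. -/
lemma col_mem {S : Set Z2} (hS : IsGood S) {δ : Z2} (hδ : ∀ y : Z2, δ ≤ y → y ∈ S)
    {a b : ℤ} (hab : (a, b) ∈ S) (hb : δ.2 ≤ b) {y : ℤ} (hy : δ.2 ≤ y) : (a, y) ∈ S :=
  row_mem hS.swap (δ := (δ.2, δ.1)) (fun z hz => hδ (z.2, z.1) ⟨hz.2, hz.1⟩)
    (show (b, a) ∈ swapSet S from hab) hb hy

/-- `c` is the conductor of `S`: the least `δ` with `δ + ℕ² ⊆ S`. -/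
def IsCond (S : Set Z2) (c : Z2) : Prop := IsLeast {δ : Z2 | ∀ y : Z2, δ ≤ y → y ∈ S} c

lemma isCond_condE {S : Set Z2} (hS : IsGood S) : IsCond S (condE S) := by
  obtain ⟨ho, -, -, hm, ⟨δ, hδ⟩, -⟩ := hS
  set D : Set Z2 := {δ : Z2 | ∀ y : Z2, δ ≤ y → y ∈ S} with hD
  have b1 : BddBelow ((fun δ : Z2 => δ.1) '' D) :=
    ⟨0, by rintro _ ⟨d, hd, rfl⟩; exact (ho (hd d le_rfl)).1⟩
  have b2 : BddBelow ((fun δ : Z2 => δ.2) '' D) :=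
    ⟨0, by rintro _ ⟨d, hd, rfl⟩; exact (ho (hd d le_rfl)).2⟩
  refine ⟨?_, fun d hd => ⟨csInf_le b1 ⟨d, hd, rfl⟩, csInf_le b2 ⟨d, hd, rfl⟩⟩⟩
  obtain ⟨d, hd, e1⟩ := Int.csInf_mem (⟨_, δ, hδ, rfl⟩ : ((fun δ : Z2 => δ.1) '' D).Nonempty) b1
  obtain ⟨d', hd', e2⟩ := Int.csInf_mem (⟨_, δ, hδ, rfl⟩ : ((fun δ : Z2 => δ.2) '' D).Nonempty) b2
  intro y hy
  have h1 : d.1 ≤ y.1 := e1.trans_le hy.1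
  have h2 : d'.2 ≤ y.2 := e2.trans_le hy.2
  have m1 : (y.1, max y.2 d.2) ∈ S := hd _ ⟨h1, by simp⟩
  have m2 : (max y.1 d'.1, y.2) ∈ S := hd' _ ⟨by simp, h2⟩
  convert hm _ m1 _ m2 using 1
  ext <;> simp

lemma col_mem_Sinf_iff {S : Set Z2} (hS : IsGood S) (a : ℤ) :
    ((a : WithTop ℤ), (⊤ : WithTop ℤ)) ∈ Sinf S ↔ ∃ N : ℤ, ∀ y, N ≤ y → (a, y) ∈ S := by
  have hc := (isCond_condE hS).1
  constructor
  · rintro (⟨b, hb, h⟩ | ⟨b, hb, h⟩)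
    · simp only [Prod.mk.injEq, WithTop.coe_inj, and_true] at hb
      subst hb
      exact ⟨_, fun y hy => col_mem hS hc h le_rfl hy⟩
    · simp at hb
  · rintro ⟨N, h⟩
    exact Or.inl ⟨a, rfl, col_mem hS hc (h (max N (condE S).2) (by simp)) (by simp) le_rfl⟩

lemma row_mem_Sinf_iff {S : Set Z2} (hS : IsGood S) (b : ℤ) :
    ((⊤ : WithTop ℤ), (b : WithTop ℤ)) ∈ Sinf S ↔ ∃ N : ℤ, ∀ x, N ≤ x → (x, b) ∈ S := by
  have hc := (isCond_condE hS).1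
  constructor
  · rintro (⟨a, ha, h⟩ | ⟨a, ha, h⟩)
    · simp at ha
    · simp only [Prod.mk.injEq, WithTop.coe_inj, true_and] at ha
      subst ha
      exact ⟨_, fun y hy => row_mem hS hc h le_rfl hy⟩
  · rintro ⟨N, h⟩
    exact Or.inr ⟨b, rfl, row_mem hS hc (h (max N (condE S).1) (by simp)) (by simp) le_rfl⟩

/-! ### Irreducible elements outside a subsemigroup -/

/-- Every sum of two nonzero elements of `S` lies in `S'`. -/
def SumsIn (S S' : Set Z2) : Prop := ∀ a ∈ S, ∀ b ∈ S, a ≠ 0 → b ≠ 0 → a + b ∈ S'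

lemma iotaZ_mem_ISet {S S' : Set Z2} (hs : SumsIn S S') (h0 : (0 : Z2) ∈ S') {s : Z2}
    (h : s ∈ S) (h' : s ∉ S') : iotaZ s ∈ ISet S := by
  have fin : ∀ w ∈ Gam S, w.1 ≠ ⊤ → w.2 ≠ ⊤ → ∃ a ∈ S, iotaZ a = w := by
    rintro w (hw | ⟨a, rfl, -⟩ | ⟨a, rfl, -⟩) h1 h2
    · exact hw
    · simp at h2
    · simp at h1
  refine ⟨Or.inl ⟨s, h, rfl⟩, ?_, ?_⟩
  · intro hs0
    simp only [iotaZ, Prod.mk_eq_zero, WithTop.coe_eq_zero] at hs0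
    exact h' ((Prod.ext hs0.1 hs0.2 : s = 0) ▸ h0)
  · intro b hb c hc e
    have e1 : ((s.1 : ℤ) : WithTop ℤ) = b.1 + c.1 := congrArg Prod.fst e
    have e2 : ((s.2 : ℤ) : WithTop ℤ) = b.2 + c.2 := congrArg Prod.snd e
    have n1 := WithTop.add_ne_top.1 (e1 ▸ WithTop.coe_ne_top)
    have n2 := WithTop.add_ne_top.1 (e2 ▸ WithTop.coe_ne_top)
    obtain ⟨b, hbS, rfl⟩ := fin b hb n1.1 n2.1
    obtain ⟨c, hcS, rfl⟩ := fin c hc n1.2 n2.2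
    have hsum : s = b + c := by
      simp only [iotaZ, ← WithTop.coe_add, WithTop.coe_inj] at e1 e2
      exact Prod.ext e1 e2
    by_cases hb0 : b = 0
    · right; rw [hsum, hb0, zero_add]
    by_cases hc0 : c = 0
    · left; rw [hsum, hc0, add_zero]
    exact absurd (hsum ▸ hs b hbS c hcS hb0 hc0) h'

lemma exists_col_approx {S : Set Z2} (hS : IsGood S) {w : Om} (hw : w ∈ Gam S) (hw0 : w ≠ 0)
    {a : ℤ} (ha : w.1 = a) (N : ℤ) :
    ∃ t : ℤ, (a, t) ∈ S ∧ (a, t) ≠ (0 : Z2) ∧ 0 ≤ t ∧ (w.2 = ⊤ → N ≤ t) := by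
  rcases hw with ⟨s, hs, rfl⟩ | hw
  · simp only [iotaZ, WithTop.coe_inj] at ha
    subst ha
    refine ⟨s.2, hs, fun h => hw0 ?_, (hS.1 hs).2, by simp [iotaZ]⟩
    have h : s = 0 := h
    simp [iotaZ, h]
  · have h2 : w.2 = ⊤ := by
      rcases hw with ⟨b, rfl, -⟩ | ⟨b, rfl, -⟩
      · rfl
      · simp at ha
    have : w = ((a : WithTop ℤ), ⊤) := Prod.ext ha h2
    rw [this, col_mem_Sinf_iff hS] at hw
    obtain ⟨M, hM⟩ := hw
    refine ⟨max M (max N 1), hM _ (by simp), fun h => ?_, by simp, by simp⟩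
    simp only [Prod.mk_eq_zero] at h
    omega

lemma exists_row_approx {S : Set Z2} (hS : IsGood S) {w : Om} (hw : w ∈ Gam S) (hw0 : w ≠ 0)
    {b : ℤ} (hb : w.2 = b) (N : ℤ) :
    ∃ t : ℤ, (t, b) ∈ S ∧ (t, b) ≠ (0 : Z2) ∧ 0 ≤ t ∧ (w.1 = ⊤ → N ≤ t) := by
  rcases hw with ⟨s, hs, rfl⟩ | hw
  · simp only [iotaZ, WithTop.coe_inj] at hb
    subst hb
    refine ⟨s.1, hs, fun h => hw0 ?_, (hS.1 hs).1, by simp [iotaZ]⟩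
    have h : s = 0 := h
    simp [iotaZ, h]
  · have h2 : w.1 = ⊤ := by
      rcases hw with ⟨b, rfl, -⟩ | ⟨b, rfl, -⟩
      · simp at hb
      · rfl
    have : w = (⊤, (b : WithTop ℤ)) := Prod.ext h2 hb
    rw [this, row_mem_Sinf_iff hS] at hw
    obtain ⟨M, hM⟩ := hw
    refine ⟨max M (max N 1), hM _ (by simp), fun h => ?_, by simp, by simp⟩
    simp only [Prod.mk_eq_zero] at h
    omega

lemma col_mem_IA {S S' : Set Z2} (hS : IsGood S) (hs : SumsIn S S') {m N : ℤ}
    (h : ∀ y, N ≤ y → (m, y) ∈ S) (h' : ∀ y, N ≤ y → (m, y) ∉ S') :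
    ((m : WithTop ℤ), (⊤ : WithTop ℤ)) ∈ IA S := by
  have hi := (col_mem_Sinf_iff hS m).2 ⟨N, h⟩
  refine ⟨⟨Or.inr hi, by simp, ?_⟩, Or.inr hi⟩
  intro b hb c hc e
  have e1 : (m : WithTop ℤ) = b.1 + c.1 := congrArg Prod.fst e
  have e2 : (⊤ : WithTop ℤ) = b.2 + c.2 := congrArg Prod.snd e
  by_cases hb0 : b = 0
  · right; rw [e, hb0, zero_add]
  by_cases hc0 : c = 0
  · left; rw [e, hc0, add_zero]
  exfalso
  have n1 := WithTop.add_ne_top.1 (e1 ▸ WithTop.coe_ne_top)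
  obtain ⟨p, hp⟩ := WithTop.ne_top_iff_exists.1 n1.1
  obtain ⟨q, hq⟩ := WithTop.ne_top_iff_exists.1 n1.2
  rw [← hp, ← hq, ← WithTop.coe_add, WithTop.coe_inj] at e1
  obtain ⟨t, ht, t0, tn, tN⟩ := exists_col_approx hS hb hb0 hp.symm N
  obtain ⟨u, hu, u0, un, uN⟩ := exists_col_approx hS hc hc0 hq.symm N
  have hsum := hs _ ht _ hu t0 u0
  rw [Prod.mk_add_mk, ← e1] at hsum
  refine h' _ ?_ hsum
  rcases WithTop.add_eq_top.1 e2.symm with h | h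
  · have := tN h; omega
  · have := uN h; omega

lemma row_mem_IA {S S' : Set Z2} (hS : IsGood S) (hs : SumsIn S S') {m N : ℤ}
    (h : ∀ x, N ≤ x → (x, m) ∈ S) (h' : ∀ x, N ≤ x → (x, m) ∉ S') :
    ((⊤ : WithTop ℤ), (m : WithTop ℤ)) ∈ IA S := by
  have hi := (row_mem_Sinf_iff hS m).2 ⟨N, h⟩
  refine ⟨⟨Or.inr hi, by simp, ?_⟩, Or.inr hi⟩
  intro b hb c hc e
  have e1 : (⊤ : WithTop ℤ) = b.1 + c.1 := congrArg Prod.fst e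
  have e2 : (m : WithTop ℤ) = b.2 + c.2 := congrArg Prod.snd e
  by_cases hb0 : b = 0
  · right; rw [e, hb0, zero_add]
  by_cases hc0 : c = 0
  · left; rw [e, hc0, add_zero]
  exfalso
  have n1 := WithTop.add_ne_top.1 (e2 ▸ WithTop.coe_ne_top)
  obtain ⟨p, hp⟩ := WithTop.ne_top_iff_exists.1 n1.1
  obtain ⟨q, hq⟩ := WithTop.ne_top_iff_exists.1 n1.2
  rw [← hp, ← hq, ← WithTop.coe_add, WithTop.coe_inj] at e2
  obtain ⟨t, ht, t0, tn, tN⟩ := exists_row_approx hS hb hb0 hp.symm N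
  obtain ⟨u, hu, u0, un, uN⟩ := exists_row_approx hS hc hc0 hq.symm N
  have hsum := hs _ ht _ hu t0 u0
  rw [Prod.mk_add_mk, ← e2] at hsum
  refine h' _ ?_ hsum
  rcases WithTop.add_eq_top.1 e1.symm with h | h
  · have := tN h; omega
  · have := uN h; omega

/-! ### Recognizing tracks -/

lemma isTrack_col {S S' : Set Z2} (hS : IsGood S) (hs : SumsIn S S') (h0 : (0 : Z2) ∈ S')
    {m N : ℤ} (h : ∀ y, N ≤ y → (m, y) ∈ S) (hd : S \ S' = {s ∈ S | s.1 = m}) :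
    IsTrack S (S \ S') := by
  have hd' : ∀ s ∈ S, s.1 = m → s ∉ S' := fun s hs hm =>
    (hd.symm ▸ (⟨hs, hm⟩ : s ∈ {s ∈ S | s.1 = m}) : s ∈ S \ S').2
  refine ⟨1, fun _ => ((m : WithTop ℤ), ⊤), ⟨le_rfl, fun _ _ =>
    col_mem_IA hS hs h fun y hy => hd' _ (h y hy) rfl, by omega, ?_, ?_, by omega⟩, ?_⟩
  · rintro s - ⟨h1, -⟩
    simp at h1
  · rintro s hsS ⟨h1, -⟩
    exact iotaZ_mem_ISet hs h0 hsS (hd' _ hsS (by simpa using h1))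
  · rw [hd]
    ext s
    simp [trackSet, finPart, lowD1, lowD2, iotaZ]

lemma isTrack_row {S S' : Set Z2} (hS : IsGood S) (hs : SumsIn S S') (h0 : (0 : Z2) ∈ S')
    {m N : ℤ} (h : ∀ x, N ≤ x → (x, m) ∈ S) (hd : S \ S' = {s ∈ S | s.2 = m}) :
    IsTrack S (S \ S') := by
  have hd' : ∀ s ∈ S, s.2 = m → s ∉ S' := fun s hs hm =>
    (hd.symm ▸ (⟨hs, hm⟩ : s ∈ {s ∈ S | s.2 = m}) : s ∈ S \ S').2
  refine ⟨1, fun _ => (⊤, (m : WithTop ℤ)), ⟨le_rfl, fun _ _ =>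
    row_mem_IA hS hs h fun y hy => hd' _ (h y hy) rfl, by omega, ?_, ?_, by omega⟩, ?_⟩
  · rintro s hsS ⟨h1, -⟩
    exact iotaZ_mem_ISet hs h0 hsS (hd' _ hsS (by simpa using h1))
  · rintro s - ⟨h1, -⟩
    simp at h1
  · rw [hd]
    ext s
    simp [trackSet, finPart, lowD1, lowD2, iotaZ]

lemma isTrack_corner {S S' : Set Z2} (hS : IsGood S) (hs : SumsIn S S') (h0 : (0 : Z2) ∈ S')
    {m b N : ℤ} (h1 : ∀ y, N ≤ y → (m, y) ∈ S) (h2 : ∀ x, N ≤ x → (x, b) ∈ S)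
    (hd : S \ S' = S ∩ DeltaUp (m, b)) : IsTrack S (S \ S') := by
  have hd' : ∀ s ∈ S, s ∈ DeltaUp (m, b) → s ∉ S' := fun s hs hm =>
    (hd.symm ▸ (⟨hs, hm⟩ : s ∈ S ∩ DeltaUp (m, b)) : s ∈ S \ S').2
  have hc : ((m : WithTop ℤ), (⊤ : WithTop ℤ)) ∈ IA S :=
    col_mem_IA hS hs (N := max N (b + 1)) (fun y hy => h1 y (by omega))
      fun y hy => hd' _ (h1 y (by omega)) (Or.inl ⟨rfl, by simp only; omega⟩)
  have hr : ((⊤ : WithTop ℤ), (b : WithTop ℤ)) ∈ IA S :=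
    row_mem_IA hS hs (N := max N (m + 1)) (fun y hy => h2 y (by omega))
      fun y hy => hd' _ (h2 y (by omega)) (Or.inr ⟨rfl, by simp only; omega⟩)
  have hup : ∀ s : Z2, s ∈ upD (((m : WithTop ℤ), (⊤ : WithTop ℤ)) ⊓ (⊤, (b : WithTop ℤ))) ↔
      s ∈ DeltaUp (m, b) := by
    intro s
    simp [upD, DeltaUp]
  refine ⟨2, fun i => if i = 0 then ((m : WithTop ℤ), ⊤) else (⊤, (b : WithTop ℤ)),
    ⟨by norm_num, ?_, ?_, ?_, ?_, ?_⟩, ?_⟩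
  · intro i _
    by_cases hi : i = 0
    · simpa [hi] using hc
    · simpa [hi] using hr
  · intro i j hij hj
    obtain rfl : i = 0 := by omega
    obtain rfl : j = 1 := by omega
    simp
  · rintro s - ⟨h, -⟩
    simp at h
  · rintro s - ⟨h, -⟩
    simp at h
  · intro i hi
    obtain rfl : i = 0 := by omega
    refine ⟨by simp, by simp, fun s hsS h => ?_⟩
    exact iotaZ_mem_ISet hs h0 hsS (hd' s hsS ((hup s).1 (by simpa using h)))
  · rw [hd]
    ext s
    have := hup s
    simp only [Prod.mk_inf_mk, inf_top_eq, top_inf_eq] at this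
    simp [trackSet, finPart, lowD1, lowD2, iotaZ, this]

/-! ### Filling the rows from a given column on -/

/-- `S` together with all the points of first coordinate at least `m` lying on a row that contains
an element of `S` of first coordinate at least `m`. -/
def fillRows (m : ℤ) (S : Set Z2) : Set Z2 :=
  {a | a ∈ S ∨ (m ≤ a.1 ∧ ∃ x, m ≤ x ∧ (x, a.2) ∈ S)}

lemma subset_fillRows (m : ℤ) (S : Set Z2) : S ⊆ fillRows m S := fun _ h => Or.inl h

lemma fillRows_of_le {m : ℤ} {S : Set Z2} {a : Z2} (ha : a ∈ fillRows m S) (h : m ≤ a.1) :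
    ∃ x, m ≤ x ∧ (x, a.2) ∈ S := by
  rcases ha with ha | ha
  · exact ⟨a.1, h, ha⟩
  · exact ha.2

lemma fillRows_of_lt {m : ℤ} {S : Set Z2} {a : Z2} (ha : a ∈ fillRows m S) (h : a.1 < m) :
    a ∈ S := by
  rcases ha with ha | ha
  · exact ha
  · omega

lemma fillRows_exists_above {m : ℤ} {S : Set Z2} (hS : IsGood S) {a b : Z2}
    (ha : a ∈ fillRows m S) (hb : b ∈ fillRows m S) (h2 : a.2 = b.2) (hlt : a.1 < b.1) :
    ∃ e ∈ fillRows m S, a.2 < e.2 ∧ e.1 = a.1 := by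
  obtain ⟨-, -, -, -, ⟨δ, hδ⟩, h3⟩ := hS
  by_cases h : m ≤ a.1
  · exact ⟨(a.1, max δ.2 (a.2 + 1)), Or.inr ⟨h, max m δ.1, by simp,
      hδ _ ⟨by simp, by simp⟩⟩, by simp only; omega, rfl⟩
  · have ha := fillRows_of_lt ha (by omega)
    obtain ⟨x, hx, hxS⟩ : ∃ x, a.1 < x ∧ (x, b.2) ∈ S := by
      rcases hb with hb | ⟨_, x, hx, hb⟩
      · exact ⟨b.1, hlt, hb⟩
      · exact ⟨x, by omega, hb⟩
    obtain ⟨e, he, h1, -, he2⟩ := (h3 _ ha _ hxS (by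
      intro h; rw [h] at hx; simp at hx)).2 h2
    have := he2 (by simp only; omega)
    exact ⟨e, Or.inl he, h1, by simp only at this; omega⟩

lemma fillRows_isGood {S : Set Z2} (hS : IsGood S) {m : ℤ} (hm0 : 0 ≤ m) :
    IsGood (fillRows m S) := by
  obtain ⟨ho, h0, ha, hm, ⟨δ, hδ⟩, h3⟩ := id hS
  have hadd : ∀ a ∈ S, ∀ b : Z2, m ≤ b.1 → (∃ x, m ≤ x ∧ (x, b.2) ∈ S) →
      a + b ∈ fillRows m S := by
    rintro a hA b hb ⟨x, hx, hxS⟩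
    have h1 : 0 ≤ a.1 := (ho hA).1
    exact Or.inr ⟨by simp only [Prod.fst_add]; omega, a.1 + x, by omega, ha _ hA _ hxS⟩
  have hmin : ∀ a ∈ S, ∀ b ∈ fillRows m S, a.1 < m → a ⊓ b ∈ S := by
    rintro a hA b (hb | ⟨hb, x, hx, hxS⟩) hlt
    · exact hm _ hA _ hb
    · convert hm _ hA _ hxS using 1
      ext <;> simp; omega
  refine ⟨?_, Or.inl h0, ?_, ?_, ⟨δ, fun y hy => Or.inl (hδ y hy)⟩, ?_⟩
  · rintro a (h | ⟨h, x, hx, hxS⟩)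
    · exact ho h
    · exact ⟨hm0.trans h, (ho hxS).2⟩
  · rintro a (hA | ⟨h, hx⟩) b hb
    · rcases hb with hB | ⟨h, hx⟩
      · exact Or.inl (ha _ hA _ hB)
      · exact hadd a hA b h hx
    · rcases hb with hB | ⟨h', x', hx', hxS'⟩
      · rw [add_comm]; exact hadd b hB a h hx
      · obtain ⟨x, hx, hxS⟩ := hx
        exact Or.inr ⟨by simp only [Prod.fst_add]; omega, x + x', by omega, ha _ hxS _ hxS'⟩
  · intro a hA b hB
    by_cases h : a.1 < m
    · exact Or.inl (hmin a (fillRows_of_lt hA h) b hB h)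
    by_cases h' : b.1 < m
    · rw [inf_comm]; exact Or.inl (hmin b (fillRows_of_lt hB h') a hA h')
    · refine Or.inr ⟨by simp only [Prod.fst_inf]; omega, ?_⟩
      rw [Prod.snd_inf]
      rcases le_total a.2 b.2 with hab | hab
      · rw [inf_eq_left.2 hab]; exact fillRows_of_le hA (by omega)
      · rw [inf_eq_right.2 hab]; exact fillRows_of_le hB (by omega)
  · intro a hA b hB hne
    refine ⟨fun h1 => ?_, fun h2 => ?_⟩
    · by_cases h : a.1 < m
      · obtain ⟨e, he, h⟩ :=
          (h3 _ (fillRows_of_lt hA h) _ (fillRows_of_lt hB (by omega)) hne).1 h1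
        exact ⟨e, Or.inl he, h⟩
      · refine ⟨(a.1 + 1, min a.2 b.2), Or.inr ⟨by simp only; omega, ?_⟩, by simp, le_rfl,
          fun _ => rfl⟩
        rcases le_total a.2 b.2 with hab | hab
        · simp only [min_eq_left hab]; exact fillRows_of_le hA (by omega)
        · simp only [min_eq_right hab]; exact fillRows_of_le hB (by omega)
    · have hne1 : a.1 ≠ b.1 := fun h => hne (Prod.ext h h2)
      rcases lt_or_gt_of_ne hne1 with hlt | hlt
      · obtain ⟨e, he, e2, e1⟩ := fillRows_exists_above hS hA hB h2 hlt
        exact ⟨e, he, e2, by omega, fun _ => by omega⟩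
      · obtain ⟨e, he, e2, e1⟩ := fillRows_exists_above hS hB hA h2.symm hlt
        exact ⟨e, he, by omega, by omega, fun _ => by omega⟩

lemma fillRows_isLocal {S : Set Z2} (hl : IsLocal S) {m : ℤ} (hm : 1 ≤ m) :
    IsLocal (fillRows m S) := by
  rintro a (ha | ⟨h, x, hx, hxS⟩) h0
  · exact hl a ha h0
  · have := hl _ hxS (Or.inr (by simp only; omega))
    simp only [Prod.mk_eq_zero] at this
    omega

section FillOneColumn

variable {S : Set Z2} {c : Z2}

lemma not_mem_col_of_isCond (hS : IsGood S) (hc : IsCond S c) {y : ℤ} (hy : c.2 ≤ y) :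
    (c.1 - 1, y) ∉ S := by
  intro h
  have : c ≤ (c.1 - 1, c.2) := hc.2 (by
    rintro z ⟨h1, h2⟩
    simp only at h1 h2
    by_cases hz : c.1 ≤ z.1
    · exact hc.1 z ⟨hz, h2⟩
    · have := col_mem hS hc.1 h hy h2
      rwa [show c.1 - 1 = z.1 by omega] at this)
  have := this.1
  simp only at this
  omega

lemma fillRows_sumsIn (hS : IsGood S) (hl : IsLocal S) (hc : IsCond S c) (h2 : 2 ≤ c.1) :
    SumsIn (fillRows (c.1 - 1) S) S := by
  have pos : ∀ a ∈ fillRows (c.1 - 1) S, a ≠ 0 → 1 ≤ a.1 := by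
    intro a ha h0
    have h1 := (fillRows_isGood hS (m := c.1 - 1) (by omega)).1 ha
    by_contra h
    exact h0 (fillRows_isLocal hl (by omega) a ha (Or.inl (by have := h1.1; omega)))
  have key : ∀ a : Z2, c.1 - 1 ≤ a.1 → (∃ x, c.1 - 1 ≤ x ∧ (x, a.2) ∈ S) →
      ∀ b ∈ fillRows (c.1 - 1) S, b ≠ 0 → a + b ∈ S := by
    rintro a ha ⟨x, hx, hxS⟩ b hb hb0
    have hb1 := pos b hb hb0
    obtain ⟨y, hy, hyS⟩ : ∃ y, 1 ≤ y ∧ (y, b.2) ∈ S := by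
      rcases hb with hb | ⟨_, y, hy, hyS⟩
      · exact ⟨b.1, hb1, hb⟩
      · exact ⟨y, by omega, hyS⟩
    have hsum := hS.2.2.1 _ hxS _ hyS
    exact row_mem hS hc.1 hsum (by omega) (by omega)
  rintro a (ha | ha) b hb ha0 hb0
  · rcases hb with hb | hb
    · exact hS.2.2.1 _ ha _ hb
    · rw [add_comm]; exact key b hb.1 hb.2 a (Or.inl ha) ha0
  · exact key a ha.1 ha.2 b hb hb0

lemma fillRows_genus (hS : IsGood S) (hc : IsCond S c) (h2 : 2 ≤ c.1) :
    genus (fillRows (c.1 - 1) S) = genus S - 1 := by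
  classical
  have hc0 : 0 ≤ c.2 := (hS.1 (hc.1 c le_rfl)).2
  obtain ⟨m, hm⟩ := Int.eq_ofNat_of_zero_le (show 0 ≤ c.1 - 1 by omega)
  obtain ⟨n, hn⟩ := Int.eq_ofNat_of_zero_le hc0
  have hcz : ∀ z : Z2, (((m + 1 : ℕ) : ℤ), (n : ℤ)) ≤ z → z ∈ S := fun z hz =>
    hc.1 z ⟨by have := hz.1; push_cast at this; omega, by have := hz.2; simp only at this; omega⟩
  have hG := fillRows_isGood hS (m := c.1 - 1) (by omega)
  have hrow0 : ∀ k ≤ m, height (fillRows (c.1 - 1) S) k 0 = height S k 0 := by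
    intro k
    induction k with
    | zero => simp [height_zero]
    | succ k ih =>
      intro hk
      rw [height_succ_left hG.2.2.2.2.2, height_succ_left hS.2.2.2.2.2, ih (by omega)]
      have : HasCol (fillRows (c.1 - 1) S) k 0 ↔ HasCol S k 0 :=
        ⟨fun ⟨t, ht, h⟩ => ⟨t, ht, fillRows_of_lt h (by simp only; omega)⟩,
          fun ⟨t, ht, h⟩ => ⟨t, ht, Or.inl h⟩⟩
      simp only [this]
  have hcol : ∀ k, height (fillRows (c.1 - 1) S) m k = height S m k := by
    intro k
    induction k with
    | zero => exact hrow0 m le_rfl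
    | succ k ih =>
      rw [height_succ_right, height_succ_right, ih]
      have : HasRow (fillRows (c.1 - 1) S) m k ↔ HasRow S m k := by
        constructor
        · rintro ⟨t, ht, h⟩
          obtain ⟨x, hx, hxS⟩ := fillRows_of_le h (by simp only; omega)
          exact ⟨x, by omega, hxS⟩
        · rintro ⟨t, ht, h⟩
          exact ⟨t, ht, Or.inl h⟩
      simp only [this]
  rw [genus_eq hS (m + 1) n hcz, genus_eq hG (m + 1) n fun z hz => Or.inl (hcz z hz),
    height_succ_left hG.2.2.2.2.2, height_succ_left hS.2.2.2.2.2, hcol, if_pos, if_neg]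
  · push_cast; ring
  · rintro ⟨t, ht, h⟩
    rw [show (m : ℤ) = c.1 - 1 by omega] at h
    exact not_mem_col_of_isCond hS hc (by omega) h
  · refine ⟨n, le_rfl, Or.inr ⟨by simp only; omega, c.1, by omega, ?_⟩⟩
    exact hc.1 _ ⟨le_rfl, by simp only; omega⟩

lemma fillRows_diff_eq_column (hS : IsGood S) (hc : IsCond S c)
    (hK : ∀ b, (c.1 - 1, b) ∉ S) :
    fillRows (c.1 - 1) S \ S = {s ∈ fillRows (c.1 - 1) S | s.1 = c.1 - 1} := by
  ext s
  constructor
  · rintro ⟨hs, hs'⟩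
    refine ⟨hs, ?_⟩
    obtain hs | ⟨h1, x, hx, hxS⟩ := hs
    · exact absurd hs hs'
    by_contra h
    have hx' : x ≠ c.1 - 1 := fun h => hK _ (h ▸ hxS)
    exact hs' (row_mem hS hc.1 hxS (by omega) (by omega))
  · rintro ⟨hs, h⟩
    exact ⟨hs, fun hs' => hK s.2 (h ▸ hs')⟩

lemma fillRows_diff_eq_deltaUp (hS : IsGood S) (hc : IsCond S c) {b : ℤ}
    (hb : (c.1 - 1, b) ∈ S) (hmax : ∀ y, (c.1 - 1, y) ∈ S → y ≤ b) :
    fillRows (c.1 - 1) S \ S = fillRows (c.1 - 1) S ∩ DeltaUp (c.1 - 1, b) := by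
  obtain ⟨-, -, -, hm, -, h3⟩ := id hS
  have hrow : ∀ x, c.1 - 1 < x → (x, b) ∉ S := by
    intro x hx h
    obtain ⟨e, he, e2, -, e1⟩ := (h3 _ hb _ h (by simp; omega)).2 rfl
    have e1 := e1 (by simp only; omega)
    simp only at e1 e2
    have := hmax e.2 (by rw [show c.1 - 1 = e.1 by omega]; exact he)
    omega
  ext s
  constructor
  · rintro ⟨hs, hs'⟩
    refine ⟨hs, ?_⟩
    obtain hs | ⟨h1, x, hx, hxS⟩ := hs
    · exact absurd hs hs'
    rcases lt_trichotomy s.2 b with hlt | heq | hgt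
    · exfalso
      have hK : (c.1 - 1, s.2) ∈ S := by
        convert hm _ hb _ hxS using 1
        ext <;> simp <;> omega
      obtain ⟨e, he, e1, -, e2⟩ := (h3 _ hK _ hb (by simp; omega)).1 rfl
      have e2 := e2 (by simp only; omega)
      simp only at e1 e2
      have he' : (e.1, s.2) ∈ S := by rw [show s.2 = e.2 by omega]; exact he
      by_cases h : s.1 = c.1 - 1
      · exact hs' (by rw [← h] at hK; exact hK)
      · exact hs' (row_mem hS hc.1 he' (by omega) (by omega))
    · refine Or.inr ⟨heq, lt_of_le_of_ne h1 fun h => hs' ?_⟩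
      simp only at h
      rw [← heq, h] at hb
      exact hb
    · refine Or.inl ⟨?_, hgt⟩
      by_contra h
      simp only at h
      have hx' : x ≠ c.1 - 1 := by
        intro h
        have := hmax s.2 (h ▸ hxS)
        omega
      exact hs' (row_mem hS hc.1 hxS (by omega) (by omega))
  · rintro ⟨hs, h⟩
    refine ⟨hs, fun hs' => ?_⟩
    rcases h with ⟨h1, h2⟩ | ⟨h1, h2⟩
    · simp only at h1 h2
      have := hmax s.2 (h1 ▸ hs')
      omega
    · simp only at h1 h2
      exact hrow s.1 h2 (h1 ▸ hs')

/-- The two shapes of the set of points added by filling one column. -/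
lemma fillRows_diff_cases (hS : IsGood S) (hc : IsCond S c) :
    (∃ N, ∀ y, N ≤ y → (c.1 - 1, y) ∈ fillRows (c.1 - 1) S) ∧
      (fillRows (c.1 - 1) S \ S = {s ∈ fillRows (c.1 - 1) S | s.1 = c.1 - 1} ∨
        ∃ b, (∃ N, ∀ x, N ≤ x → (x, b) ∈ fillRows (c.1 - 1) S) ∧
          fillRows (c.1 - 1) S \ S = fillRows (c.1 - 1) S ∩ DeltaUp (c.1 - 1, b)) := by
  refine ⟨⟨c.2, fun y hy => Or.inr ⟨le_rfl, c.1, by omega, hc.1 _ ⟨le_rfl, hy⟩⟩⟩, ?_⟩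
  by_cases hK : ∀ b, (c.1 - 1, b) ∉ S
  · exact Or.inl (fillRows_diff_eq_column hS hc hK)
  · push Not at hK
    obtain ⟨b, hb, hmax⟩ := Int.exists_greatest_of_bdd (P := fun b => (c.1 - 1, b) ∈ S)
      ⟨c.2, fun y hy => by
        by_contra h
        exact not_mem_col_of_isCond hS hc (by omega) hy⟩ hK
    exact Or.inr ⟨b, ⟨c.1 - 1, fun x hx => Or.inr ⟨hx, _, le_rfl, hb⟩⟩,
      fillRows_diff_eq_deltaUp hS hc hb hmax⟩

end FillOneColumn

lemma IsCond.swap {S : Set Z2} {c : Z2} (hc : IsCond S c) : IsCond (swapSet S) (c.2, c.1) := by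
  refine ⟨fun y hy => hc.1 _ ⟨hy.2, hy.1⟩, fun d hd => ?_⟩
  have : c ≤ (d.2, d.1) := hc.2 fun y hy => hd (y.2, y.1) ⟨hy.2, hy.1⟩
  exact ⟨this.2, this.1⟩

lemma exists_parent_of_two_le_fst {S : Set Z2} {c : Z2} (hS : IsGood S) (hl : IsLocal S)
    (hc : IsCond S c) (h2 : 2 ≤ c.1) :
    ∃ R : Set Z2, IsGood R ∧ IsLocal R ∧ genus R = genus S - 1 ∧ IsTrack R (R \ S) ∧ S ⊆ R := by
  have hG := fillRows_isGood hS (m := c.1 - 1) (by omega)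
  have hs := fillRows_sumsIn hS hl hc h2
  refine ⟨fillRows (c.1 - 1) S, hG, fillRows_isLocal hl (by omega), fillRows_genus hS hc h2, ?_,
    subset_fillRows _ _⟩
  obtain ⟨⟨N, hN⟩, hd | ⟨b, ⟨M, hM⟩, hd⟩⟩ := fillRows_diff_cases hS hc
  · exact isTrack_col hG hs hS.2.1 hN hd
  · exact isTrack_corner hG hs hS.2.1 (N := max N M) (fun y hy => hN y (by omega))
      (fun x hx => hM x (by omega)) hd

lemma exists_parent_of_two_le_snd {S : Set Z2} {c : Z2} (hS : IsGood S) (hl : IsLocal S)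
    (hc : IsCond S c) (h2 : 2 ≤ c.2) :
    ∃ R : Set Z2, IsGood R ∧ IsLocal R ∧ genus R = genus S - 1 ∧ IsTrack R (R \ S) ∧ S ⊆ R := by
  have hG := fillRows_isGood hS.swap (m := c.2 - 1) (by omega)
  have hs : SumsIn (swapSet (fillRows (c.2 - 1) (swapSet S))) S := fun a ha b hb ha0 hb0 =>
    fillRows_sumsIn hS.swap hl.swap hc.swap h2 (a.2, a.1) ha (b.2, b.1) hb
      (fun h => ha0 (by simp only [Prod.mk_eq_zero] at h; exact Prod.ext h.2 h.1))
      (fun h => hb0 (by simp only [Prod.mk_eq_zero] at h; exact Prod.ext h.2 h.1))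
  refine ⟨swapSet (fillRows (c.2 - 1) (swapSet S)), hG.swap,
    (fillRows_isLocal hl.swap (by omega)).swap, ?_, ?_, fun a ha => Or.inl ha⟩
  · rw [genus_swapSet hG, ← genus_swapSet hS]
    exact fillRows_genus hS.swap hc.swap h2
  obtain ⟨⟨N, hN⟩, hd | ⟨b, ⟨M, hM⟩, hd⟩⟩ := fillRows_diff_cases hS.swap hc.swap
  · refine isTrack_row hG.swap hs hS.2.1 hN (m := c.2 - 1) ?_
    ext s
    exact Set.ext_iff.1 hd (s.2, s.1)
  · refine isTrack_corner hG.swap hs hS.2.1 (N := max N M) (m := b) (b := c.2 - 1)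
      (fun y hy => hM y (by omega)) (fun x hx => hN x (by omega)) ?_
    ext s
    refine (Set.ext_iff.1 hd (s.2, s.1)).trans (and_congr Iff.rfl ?_)
    exact or_comm

/-- Every local good semigroup `S' ⊆ ℕ²` with `S' ≠ ℕ²(1,1)`
is obtained from a local good semigroup of genus `g(S') − 1` by removing a
track. -/
theorem exists_parent_of_genus_pred (S' : Set Z2) (hS' : IsGood S')
    (hl' : IsLocal S') (hne : S' ≠ N2oneone) :
    ∃ S T : Set Z2, IsGood S ∧ IsLocal S ∧ genus S = genus S' - 1 ∧
      IsTrack S T ∧ S' = S \ T := by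
  have hc := isCond_condE hS'
  set c := condE S'
  have hc0 : 0 ≤ c.1 ∧ 0 ≤ c.2 := hS'.1 (hc.1 c le_rfl)
  have key : 2 ≤ c.1 ∨ 2 ≤ c.2 := by
    by_contra! h
    refine hne (Set.ext fun a => ⟨fun ha => ?_, ?_⟩)
    · by_cases h0 : a = 0
      · exact Or.inl h0
      have hao : 0 ≤ a.1 ∧ 0 ≤ a.2 := hS'.1 ha
      have h1 : ¬ (a.1 = 0 ∨ a.2 = 0) := fun h => h0 (hl' a ha h)
      exact Or.inr ⟨by simp only; omega, by simp only; omega⟩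
    · rintro (rfl | ⟨h1, h2⟩)
      · exact hS'.2.1
      · simp only at h1 h2
        exact hc.1 a ⟨by omega, by omega⟩
  obtain ⟨R, hR, hRl, hg, hT, hsub⟩ := key.elim (exists_parent_of_two_le_fst hS' hl' hc)
    (exists_parent_of_two_le_snd hS' hl' hc)
  exact ⟨R, R \ S', hR, hRl, hg, hT, (Set.sdiff_sdiff_cancel_left hsub).symm⟩
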